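/- arXiv:1205.3697 — 6 statements merged into one kernel-verified Lean document; each statement's English description precedes it below -/
import Mathlib

section
/- Suppose u, p : (0,∞) × (0,∞) → ℝ and d : (0,∞) × (0,∞) → ℝ³ are smooth, |d(t,r)| = 1 for all t, r, and they satisfy the reduced system: ∂ₜu = ∂ᵣᵣu + (1/r)∂ᵣu − (1/r²)u; ∂ᵣp = (1/r)u² − (1/2)∂ᵣ(|∂ᵣd|²) − (∂ᵣᵣd + (1/r)∂ᵣd)·∂ᵣd; ∂ₜd = ∂ᵣᵣd + (1/r)∂ᵣd + |∂ᵣd|² d. Then the fields u⃗(t,x) = u(t,|x|) e_θ(x), P(t,x) = p(t,|x|), D(t,x) = d(t,|x|) satisfy, for all t > 0 and x ∈ ℝ² \ {0}: ∂ₜu⃗ + (u⃗·∇)u⃗ + ∇P = Δu⃗ − ∇·(∇D ⊗ ∇D), ∂ₜD + (u⃗·∇)D = ΔD + |∇D|² D, ∇·u⃗ = 0 and |D| = 1. -/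
open Real Set RealInnerProductSpace

noncomputable section

/-- Partial derivative in the `i`-th coordinate direction of a scalar function on `ℝ²`. -/
def pd (i : Fin 2) (f : EuclideanSpace ℝ (Fin 2) → ℝ) (x : EuclideanSpace ℝ (Fin 2)) : ℝ :=
  fderiv ℝ f x (EuclideanSpace.single i 1)

/-- The unit angular vector field `e_θ(x) = (−x₂/|x|, x₁/|x|)` on `ℝ² \ {0}`. -/
def etheta (x : EuclideanSpace ℝ (Fin 2)) : EuclideanSpace ℝ (Fin 2) :=
  EuclideanSpace.single 0 (-(x 1) / ‖x‖) + EuclideanSpace.single 1 (x 0 / ‖x‖)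

section PartialDerivatives

variable {x : EuclideanSpace ℝ (Fin 2)}

lemma HasFDerivAt.pd_eq {f : EuclideanSpace ℝ (Fin 2) → ℝ} {f' : EuclideanSpace ℝ (Fin 2) →L[ℝ] ℝ}
    (hf : HasFDerivAt f f' x) (i : Fin 2) : pd i f x = f' (EuclideanSpace.single i 1) := by
  rw [pd, hf.fderiv]

lemma pd_congr_of_ne_zero {f g : EuclideanSpace ℝ (Fin 2) → ℝ} (hfg : ∀ y, y ≠ 0 → f y = g y)
    (hx : x ≠ 0) (i : Fin 2) : pd i f x = pd i g x := by
  have h : f =ᶠ[nhds x] g := by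
    filter_upwards [isOpen_ne.mem_nhds hx] with y hy using hfg y hy
  rw [pd, pd, h.fderiv_eq]

lemma hasFDerivAt_comp_norm {φ : ℝ → ℝ} {c : ℝ} (hx : x ≠ 0) (hφ : HasDerivAt φ c ‖x‖) :
    HasFDerivAt (fun y : EuclideanSpace ℝ (Fin 2) => φ ‖y‖) ((c / ‖x‖) • innerSL ℝ x) x := by
  have hn : ‖x‖ ≠ 0 := norm_ne_zero_iff.mpr hx
  have h₁ := (hasStrictFDerivAt_norm_sq x).hasFDerivAt.sqrt (pow_ne_zero 2 hn)
  have h₂ : HasFDerivAt (fun y : EuclideanSpace ℝ (Fin 2) => ‖y‖) (‖x‖⁻¹ • innerSL ℝ x) x := by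
    refine (h₁.congr_fderiv ?_).congr_of_eventuallyEq (.of_forall fun y => ?_)
    · ext v
      simp
      field_simp
    · simp
  refine (hφ.comp_hasFDerivAt x h₂).congr_fderiv ?_
  rw [smul_smul, div_eq_mul_inv]

lemma hasFDerivAt_coord (a : Fin 2) :
    HasFDerivAt (fun y : EuclideanSpace ℝ (Fin 2) => y a)
      (EuclideanSpace.proj a : EuclideanSpace ℝ (Fin 2) →L[ℝ] ℝ) x :=
  (EuclideanSpace.proj a : EuclideanSpace ℝ (Fin 2) →L[ℝ] ℝ).hasFDerivAt

lemma pd_comp_norm {φ : ℝ → ℝ} {c : ℝ} (hx : x ≠ 0) (hφ : HasDerivAt φ c ‖x‖) (i : Fin 2) :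
    pd i (fun y => φ ‖y‖) x = c / ‖x‖ * x i := by
  rw [(hasFDerivAt_comp_norm hx hφ).pd_eq]
  simp [EuclideanSpace.inner_single_right]

lemma pd_comp_norm_mul_coord {φ : ℝ → ℝ} {c : ℝ} (hx : x ≠ 0) (hφ : HasDerivAt φ c ‖x‖)
    (a i : Fin 2) :
    pd i (fun y => φ ‖y‖ * y a) x
      = c / ‖x‖ * (x i * x a) + φ ‖x‖ * (if a = i then 1 else 0) := by
  rw [((hasFDerivAt_comp_norm hx hφ).fun_mul (hasFDerivAt_coord a)).pd_eq]
  simp [EuclideanSpace.inner_single_right]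
  ring

lemma pd_comp_norm_mul_coord_mul_coord {φ : ℝ → ℝ} {c : ℝ} (hx : x ≠ 0)
    (hφ : HasDerivAt φ c ‖x‖) (a b i : Fin 2) :
    pd i (fun y => φ ‖y‖ * (y a * y b)) x
      = c / ‖x‖ * (x i * x a * x b)
        + φ ‖x‖ * ((if a = i then x b else 0) + if b = i then x a else 0) := by
  rw [((hasFDerivAt_comp_norm hx hφ).fun_mul
    ((hasFDerivAt_coord a).fun_mul (hasFDerivAt_coord b))).pd_eq]
  simp [EuclideanSpace.inner_single_right]
  split_ifs <;> ring

lemma sq_add_sq_eq_norm_sq (x : EuclideanSpace ℝ (Fin 2)) : x 0 ^ 2 + x 1 ^ 2 = ‖x‖ ^ 2 := by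
  rw [EuclideanSpace.real_norm_sq_eq, Fin.sum_univ_two]

lemma hasDerivAt_div_id {φ : ℝ → ℝ} {c r : ℝ} (hr : 0 < r) (hφ : HasDerivAt φ c r) :
    HasDerivAt (fun ρ => φ ρ / ρ) (c / r - φ r / r ^ 2) r := by
  refine (hφ.div (hasDerivAt_id r) hr.ne').congr_deriv ?_
  simp only [id]
  field_simp

/-- The Laplacian of a radial function on the punctured plane. -/
lemma sum_pd_pd_comp_norm {φ φ' : ℝ → ℝ} {c : ℝ} (hx : x ≠ 0)
    (hφ : ∀ ρ, 0 < ρ → HasDerivAt φ (φ' ρ) ρ) (hφ' : HasDerivAt φ' c ‖x‖) :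
    ∑ j : Fin 2, pd j (pd j (fun y => φ ‖y‖)) x = c + φ' ‖x‖ / ‖x‖ := by
  have hr : 0 < ‖x‖ := norm_pos_iff.mpr hx
  have h : ∀ j : Fin 2, pd j (pd j (fun y => φ ‖y‖)) x
      = pd j (fun y => φ' ‖y‖ / ‖y‖ * y j) x := fun j =>
    pd_congr_of_ne_zero (fun y hy => pd_comp_norm hy (hφ _ (norm_pos_iff.mpr hy)) j) hx j
  simp only [h, pd_comp_norm_mul_coord hx (hasDerivAt_div_id hr hφ'), Fin.sum_univ_two, if_true]
  have := sq_add_sq_eq_norm_sq x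
  field_simp
  linear_combination (c * ‖x‖ - φ' ‖x‖) * this

/-- The Laplacian of a radial function times a coordinate on the punctured plane. -/
lemma sum_pd_pd_comp_norm_mul_coord {φ φ' : ℝ → ℝ} {c : ℝ} (hx : x ≠ 0)
    (hφ : ∀ ρ, 0 < ρ → HasDerivAt φ (φ' ρ) ρ) (hφ' : HasDerivAt φ' c ‖x‖) (a : Fin 2) :
    ∑ j : Fin 2, pd j (pd j (fun y => φ ‖y‖ * y a)) x = (c + 3 * φ' ‖x‖ / ‖x‖) * x a := by
  have hr : 0 < ‖x‖ := norm_pos_iff.mpr hx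
  have h : ∀ j : Fin 2, pd j (pd j (fun y => φ ‖y‖ * y a)) x
      = pd j (fun y => φ' ‖y‖ / ‖y‖ * (y j * y a)) x
        + pd j (fun y => φ ‖y‖) x * (if a = j then 1 else 0) := by
    intro j
    rw [pd_congr_of_ne_zero (fun y hy =>
      pd_comp_norm_mul_coord hy (hφ _ (norm_pos_iff.mpr hy)) a j) hx j]
    have h₁ := (hasFDerivAt_comp_norm hx (hasDerivAt_div_id hr hφ')).fun_mul
      ((hasFDerivAt_coord j).fun_mul (hasFDerivAt_coord a))
    have h₂ := hasFDerivAt_comp_norm hx (hφ _ hr)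
    rw [(h₁.fun_add (h₂.mul_const (if a = j then 1 else 0))).pd_eq, HasFDerivAt.pd_eq h₁,
      h₂.pd_eq]
    split_ifs <;> simp
  simp only [h, pd_comp_norm_mul_coord_mul_coord hx (hasDerivAt_div_id hr hφ'),
    pd_comp_norm hx (hφ _ hr), Fin.sum_univ_two]
  have := sq_add_sq_eq_norm_sq x
  fin_cases a <;> simp <;> field_simp
  · linear_combination (c * ‖x‖ - φ' ‖x‖) * x 0 * this
  · linear_combination (c * ‖x‖ - φ' ‖x‖) * x 1 * this

/-- The divergence of a radial multiple of the tensor `x ⊗ x` on the punctured plane. -/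
lemma sum_pd_comp_norm_mul_coord_mul_coord {φ : ℝ → ℝ} {c : ℝ} (hx : x ≠ 0)
    (hφ : HasDerivAt φ c ‖x‖) (i : Fin 2) :
    ∑ j : Fin 2, pd j (fun y => φ ‖y‖ * (y i * y j)) x = (c * ‖x‖ + 3 * φ ‖x‖) * x i := by
  have hr : ‖x‖ ≠ 0 := norm_ne_zero_iff.mpr hx
  simp only [pd_comp_norm_mul_coord_mul_coord hx hφ, Fin.sum_univ_two]
  have := sq_add_sq_eq_norm_sq x
  fin_cases i <;> simp <;> field_simp
  · linear_combination c * x 0 * this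
  · linear_combination c * x 1 * this

end PartialDerivatives

section Slices

variable {E : Type*} [NormedAddCommGroup E] [NormedSpace ℝ E]

lemma ContDiffOn.hasDerivAt_Ioi {f : ℝ → E} (hf : ContDiffOn ℝ (⊤ : ℕ∞) f (Ioi 0)) {r : ℝ}
    (hr : 0 < r) : HasDerivAt f (deriv f r) r :=
  ((hf.differentiableOn (by simp)).differentiableAt (Ioi_mem_nhds hr)).hasDerivAt

lemma ContDiffOn.deriv_Ioi {f : ℝ → E} (hf : ContDiffOn ℝ (⊤ : ℕ∞) f (Ioi 0)) :
    ContDiffOn ℝ (⊤ : ℕ∞) (deriv f) (Ioi 0) :=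
  ((contDiffOn_infty_iff_deriv_of_isOpen isOpen_Ioi).mp hf).2

lemma ContDiffOn.slice_right {f : ℝ → ℝ → E}
    (hf : ContDiffOn ℝ (⊤ : ℕ∞) (fun q : ℝ × ℝ => f q.1 q.2) (Ioi 0 ×ˢ Ioi 0)) {t : ℝ}
    (ht : 0 < t) : ContDiffOn ℝ (⊤ : ℕ∞) (f t) (Ioi 0) :=
  hf.comp (g := fun q : ℝ × ℝ => f q.1 q.2) (f := fun r => (t, r))
    (contDiff_const.prodMk contDiff_id).contDiffOn fun _ hr => ⟨ht, hr⟩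

lemma ContDiffOn.slice_left {f : ℝ → ℝ → E}
    (hf : ContDiffOn ℝ (⊤ : ℕ∞) (fun q : ℝ × ℝ => f q.1 q.2) (Ioi 0 ×ˢ Ioi 0)) {r : ℝ}
    (hr : 0 < r) : ContDiffOn ℝ (⊤ : ℕ∞) (fun t => f t r) (Ioi 0) :=
  hf.comp (g := fun q : ℝ × ℝ => f q.1 q.2) (f := fun t => (t, r))
    (contDiff_id.prodMk contDiff_const).contDiffOn fun _ ht => ⟨ht, hr⟩

lemma HasDerivAt.euclidean_apply {ι : Type*} [Fintype ι] {f : ℝ → EuclideanSpace ℝ ι}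
    {f' : EuclideanSpace ℝ ι} {r : ℝ} (hf : HasDerivAt f f' r) (m : ι) :
    HasDerivAt (fun ρ => f ρ m) (f' m) r :=
  (EuclideanSpace.proj m : EuclideanSpace ℝ ι →L[ℝ] ℝ).hasFDerivAt.comp_hasDerivAt r hf

end Slices

/-- A smooth solution `(u, p, d)` of the reduced radial system
gives, via `u⃗(t,x) = u(t,|x|)e_θ(x)`, `P(t,x) = p(t,|x|)`, `D(t,x) = d(t,|x|)`,
a solution of the two-dimensional liquid crystal system on `ℝ² \ {0}`. -/
theorem reduced_system_gives_full_system
    (u p : ℝ → ℝ → ℝ) (d : ℝ → ℝ → EuclideanSpace ℝ (Fin 3))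
    (hu_smooth : ContDiffOn ℝ (⊤ : ℕ∞) (fun q : ℝ × ℝ => u q.1 q.2) (Ioi 0 ×ˢ Ioi 0))
    (hp_smooth : ContDiffOn ℝ (⊤ : ℕ∞) (fun q : ℝ × ℝ => p q.1 q.2) (Ioi 0 ×ˢ Ioi 0))
    (hd_smooth : ContDiffOn ℝ (⊤ : ℕ∞) (fun q : ℝ × ℝ => d q.1 q.2) (Ioi 0 ×ˢ Ioi 0))
    (hd_unit : ∀ t ∈ Ioi (0:ℝ), ∀ r ∈ Ioi (0:ℝ), ‖d t r‖ = 1)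
    (hu_eq : ∀ t ∈ Ioi (0:ℝ), ∀ r ∈ Ioi (0:ℝ),
      deriv (fun s => u s r) t
        = deriv (deriv (u t)) r + (1/r) * deriv (u t) r - (1/r^2) * u t r)
    (hp_eq : ∀ t ∈ Ioi (0:ℝ), ∀ r ∈ Ioi (0:ℝ),
      deriv (p t) r
        = (1/r) * (u t r)^2 - (1/2) * deriv (fun ρ => ‖deriv (d t) ρ‖^2) r
          - ⟪deriv (deriv (d t)) r + (1/r) • deriv (d t) r, deriv (d t) r⟫)
    (hd_eq : ∀ t ∈ Ioi (0:ℝ), ∀ r ∈ Ioi (0:ℝ),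
      deriv (fun s => d s r) t
        = deriv (deriv (d t)) r + (1/r) • deriv (d t) r
          + (‖deriv (d t) r‖^2) • d t r)
    (U : ℝ → EuclideanSpace ℝ (Fin 2) → EuclideanSpace ℝ (Fin 2))
    (P : ℝ → EuclideanSpace ℝ (Fin 2) → ℝ)
    (D : ℝ → EuclideanSpace ℝ (Fin 2) → EuclideanSpace ℝ (Fin 3))
    (hU : ∀ t x, U t x = u t ‖x‖ • etheta x)
    (hP : ∀ t x, P t x = p t ‖x‖)
    (hD : ∀ t x, D t x = d t ‖x‖) :
    ∀ t ∈ Ioi (0:ℝ), ∀ x : EuclideanSpace ℝ (Fin 2), x ≠ 0 →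
      -- momentum equation, componentwise
      (∀ i : Fin 2,
        deriv (fun s => U s x i) t
          + (∑ j : Fin 2, U t x j * pd j (fun y => U t y i) x)
          + pd i (P t) x
        = (∑ j : Fin 2, pd j (pd j (fun y => U t y i)) x)
          - ∑ j : Fin 2, pd j
              (fun y => ∑ m : Fin 3,
                pd i (fun z => D t z m) y * pd j (fun z => D t z m) y) x) ∧
      -- orientation equation, componentwise
      (∀ m : Fin 3,
        deriv (fun s => D s x m) t
          + ∑ j : Fin 2, U t x j * pd j (fun y => D t y m) x
        = (∑ j : Fin 2, pd j (pd j (fun y => D t y m)) x)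
          + (∑ j : Fin 2, ∑ m' : Fin 3, (pd j (fun y => D t y m') x) ^ 2)
              * D t x m) ∧
      -- incompressibility
      (∑ j : Fin 2, pd j (fun y => U t y j) x = 0) ∧
      -- unit length
      ‖D t x‖ = 1 := by
  intro t ht x hx
  have hr : 0 < ‖x‖ := norm_pos_iff.mpr hx
  have hxx := sq_add_sq_eq_norm_sq x
  have ht' : 0 < t := ht
  have hu := hu_smooth.slice_right ht'
  have hd := hd_smooth.slice_right ht'
  have hDfun : D t = fun y => d t ‖y‖ := funext (hD t)
  have hdm : ∀ m ρ, 0 < ρ → HasDerivAt (fun ρ => d t ρ m) (deriv (d t) ρ m) ρ :=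
    fun m ρ hρ => (hd.hasDerivAt_Ioi hρ).euclidean_apply m
  have hdm' := fun m => (hd.deriv_Ioi.hasDerivAt_Ioi hr).euclidean_apply m
  have hpdD : ∀ y, y ≠ 0 → ∀ m j, pd j (fun y => D t y m) y = deriv (d t) ‖y‖ m / ‖y‖ * y j := by
    intro y hy m j
    rw [hDfun]
    exact pd_comp_norm hy (hdm m _ (norm_pos_iff.mpr hy)) j
  have hU₀ : ∀ s y, U s y 0 = -(u s ‖y‖ / ‖y‖) * y 1 := by
    intro s y
    simp [hU, etheta]
    ring
  have hU₁ : ∀ s y, U s y 1 = u s ‖y‖ / ‖y‖ * y 0 := by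
    intro s y
    simp [hU, etheta]
    ring
  have hw : ∀ ρ, 0 < ρ → HasDerivAt (fun ρ => u t ρ / ρ) (deriv (u t) ρ / ρ - u t ρ / ρ ^ 2) ρ :=
    fun ρ hρ => hasDerivAt_div_id hρ (hu.hasDerivAt_Ioi hρ)
  have hw' : HasDerivAt (fun ρ => deriv (u t) ρ / ρ - u t ρ / ρ ^ 2)
      (deriv (deriv (u t)) ‖x‖ / ‖x‖ - 2 * deriv (u t) ‖x‖ / ‖x‖ ^ 2
        + 2 * u t ‖x‖ / ‖x‖ ^ 3) ‖x‖ := by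
    refine ((hasDerivAt_div_id hr (hu.deriv_Ioi.hasDerivAt_Ioi hr)).sub
      ((hu.hasDerivAt_Ioi hr).div (hasDerivAt_pow 2 ‖x‖) (pow_ne_zero 2 hr.ne'))).congr_deriv ?_
    field_simp
    ring
  have hpd₀ : ∀ j, pd j (fun y => U t y 0) x = _ := fun j => by
    simp only [hU₀]
    exact pd_comp_norm_mul_coord hx (hw _ hr).fun_neg 1 j
  have hpd₁ : ∀ j, pd j (fun y => U t y 1) x = _ := fun j => by
    simp only [hU₁]
    exact pd_comp_norm_mul_coord hx (hw _ hr) 0 j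
  have hlap₀ : ∑ j : Fin 2, pd j (pd j (fun y => U t y 0)) x
      = (-(deriv (deriv (u t)) ‖x‖ / ‖x‖ - 2 * deriv (u t) ‖x‖ / ‖x‖ ^ 2
        + 2 * u t ‖x‖ / ‖x‖ ^ 3)
        + 3 * -(deriv (u t) ‖x‖ / ‖x‖ - u t ‖x‖ / ‖x‖ ^ 2) / ‖x‖) * x 1 := by
    simp only [hU₀]
    exact sum_pd_pd_comp_norm_mul_coord (φ := fun ρ => -(u t ρ / ρ)) hx
      (fun ρ hρ => (hw ρ hρ).fun_neg) hw'.fun_neg 1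
  have hlap₁ : ∑ j : Fin 2, pd j (pd j (fun y => U t y 1)) x
      = ((deriv (deriv (u t)) ‖x‖ / ‖x‖ - 2 * deriv (u t) ‖x‖ / ‖x‖ ^ 2
        + 2 * u t ‖x‖ / ‖x‖ ^ 3)
        + 3 * (deriv (u t) ‖x‖ / ‖x‖ - u t ‖x‖ / ‖x‖ ^ 2) / ‖x‖) * x 0 := by
    simp only [hU₁]
    exact sum_pd_pd_comp_norm_mul_coord (φ := fun ρ => u t ρ / ρ) hx hw hw' 0
  have hut := (hu_smooth.slice_left hr).hasDerivAt_Ioi ht'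
  have hdt₀ : deriv (fun s => U s x 0) t = -(deriv (fun s => u s ‖x‖) t / ‖x‖) * x 1 := by
    simp only [hU₀]
    exact ((hut.div_const ‖x‖).fun_neg.mul_const (x 1)).deriv
  have hdt₁ : deriv (fun s => U s x 1) t = deriv (fun s => u s ‖x‖) t / ‖x‖ * x 0 := by
    simp only [hU₁]
    exact ((hut.div_const ‖x‖).mul_const (x 0)).deriv
  have hG := (hd.deriv_Ioi.hasDerivAt_Ioi hr).norm_sq
  have hstress : ∀ i : Fin 2, ∑ j : Fin 2, pd j
      (fun y => ∑ m : Fin 3, pd i (fun z => D t z m) y * pd j (fun z => D t z m) y) x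
      = (2 * ⟪deriv (d t) ‖x‖, deriv (deriv (d t)) ‖x‖⟫
          + ‖deriv (d t) ‖x‖‖ ^ 2 / ‖x‖) / ‖x‖ * x i := by
    intro i
    have h : ∀ j : Fin 2, pd j
        (fun y => ∑ m : Fin 3, pd i (fun z => D t z m) y * pd j (fun z => D t z m) y) x
        = pd j (fun y => ‖deriv (d t) ‖y‖‖ ^ 2 / ‖y‖ ^ 2 * (y i * y j)) x := fun j =>
      pd_congr_of_ne_zero (fun y hy => by
        simp only [hpdD y hy, EuclideanSpace.real_norm_sq_eq (deriv (d t) ‖y‖), Finset.sum_div,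
          Finset.sum_mul]
        exact Finset.sum_congr rfl fun m _ => by ring) hx j
    simp only [h]
    rw [sum_pd_comp_norm_mul_coord_mul_coord (φ := fun ρ => ‖deriv (d t) ρ‖ ^ 2 / ρ ^ 2) hx
      (hG.div (hasDerivAt_pow 2 ‖x‖) (pow_ne_zero 2 hr.ne'))]
    field_simp
    ring
  have hpdP : ∀ i, pd i (P t) x = deriv (p t) ‖x‖ / ‖x‖ * x i := by
    rw [show P t = fun y => p t ‖y‖ from funext (hP t)]
    exact pd_comp_norm hx ((hp_smooth.slice_right ht').hasDerivAt_Ioi hr)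
  have hp := hp_eq t ht _ hr
  rw [hG.deriv, inner_add_left, inner_smul_left, real_inner_self_eq_norm_sq,
    real_inner_comm (deriv (d t) ‖x‖) (deriv (deriv (d t)) ‖x‖)] at hp
  simp only [conj_trivial] at hp
  refine ⟨fun i => ?_, fun m => ?_, ?_, ?_⟩
  · rw [hstress, hpdP, hp]
    revert i
    refine Fin.forall_fin_two.mpr ⟨?_, ?_⟩
    · rw [hdt₀, hlap₀, hu_eq t ht _ hr, Fin.sum_univ_two, hpd₀, hpd₀, hU₀, hU₁]
      simp
      field_simp
      ring
    · rw [hdt₁, hlap₁, hu_eq t ht _ hr, Fin.sum_univ_two, hpd₁, hpd₁, hU₀, hU₁]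
      simp
      field_simp
      ring
  · have hlap := sum_pd_pd_comp_norm hx (hdm m) (hdm' m)
    have hdt : deriv (fun s => D s x m) t = deriv (fun s => d s ‖x‖) t m := by
      simp only [hD]
      exact (((hd_smooth.slice_left hr).hasDerivAt_Ioi ht').euclidean_apply m).deriv
    have hgrad : ∑ j : Fin 2, ∑ m' : Fin 3, (pd j (fun y => D t y m') x) ^ 2
        = ‖deriv (d t) ‖x‖‖ ^ 2 := by
      simp only [hpdD x hx, EuclideanSpace.real_norm_sq_eq (deriv (d t) ‖x‖), Fin.sum_univ_two,
        Fin.sum_univ_three]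
      field_simp
      rw [← hxx]
      ring
    have hadv : ∑ j : Fin 2, U t x j * pd j (fun y => D t y m) x = 0 := by
      simp only [hpdD x hx, Fin.sum_univ_two, hU₀, hU₁]
      ring
    rw [hadv, hgrad, hdt, hd_eq t ht _ hr, hDfun, hlap]
    simp
    ring
  · rw [Fin.sum_univ_two, hpd₀, hpd₁]
    simp
    ring
  · rw [hD]
    exact hd_unit t ht _ hr


end
end

section
/- Let J ⊂ (0,π) be an open interval and Φ : J → ℝ a smooth function satisfying the ODE Φ''(ψ) sin²ψ + 2Φ'(ψ) cos ψ sin ψ + (Φ'(ψ))³ cos ψ sin³ψ = 0 on J. Let ψ : (0,∞) × (0,∞) → ℝ be a smooth function with values in J satisfying ∂ₜψ = ∂ᵣᵣψ + (1/r)∂ᵣψ − (Φ'(ψ))² cos ψ sin ψ (∂ᵣψ)². Then the pair (ψ, φ) with φ = Φ ∘ ψ satisfies ∂ₜψ = ∂ᵣᵣψ + (1/r)∂ᵣψ − cos ψ sin ψ (∂ᵣφ)² and (∂ₜφ) sin²ψ = (∂ᵣᵣφ + (1/r)∂ᵣφ) sin²ψ + 2 cos ψ sin ψ (∂ᵣψ)(∂ᵣφ).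 -/
open Real Set

/-- If `Φ` solves the ODE
`Φ'' sin²ψ + 2Φ' cos ψ sin ψ + (Φ')³ cos ψ sin³ψ = 0` on an open interval `J ⊆ (0,π)`,
and `ψ(t,r)` (with values in `J`) solves
`∂ₜψ = ∂ᵣᵣψ + (1/r)∂ᵣψ − (Φ'(ψ))² cos ψ sin ψ (∂ᵣψ)²`,
then `(ψ, φ)` with `φ = Φ ∘ ψ` solves the reduced orientation system. -/
theorem curve_ansatz_reduces_system
    (a b : ℝ) (J : Set ℝ) (hJ : J = Ioo a b) (hJsub : J ⊆ Ioo 0 π)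
    (Φ : ℝ → ℝ) (hΦ : ContDiffOn ℝ (⊤ : ℕ∞) Φ J)
    (hODE : ∀ ψ ∈ J,
      deriv (deriv Φ) ψ * sin ψ ^ 2 + 2 * deriv Φ ψ * cos ψ * sin ψ
        + (deriv Φ ψ) ^ 3 * cos ψ * sin ψ ^ 3 = 0)
    (ψ : ℝ → ℝ → ℝ)
    (hψ_smooth : ContDiffOn ℝ (⊤ : ℕ∞) (fun q : ℝ × ℝ => ψ q.1 q.2) (Ioi 0 ×ˢ Ioi 0))
    (hψ_range : ∀ t ∈ Ioi (0:ℝ), ∀ r ∈ Ioi (0:ℝ), ψ t r ∈ J)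
    (hψ_eq : ∀ t ∈ Ioi (0:ℝ), ∀ r ∈ Ioi (0:ℝ),
      deriv (fun s => ψ s r) t
        = deriv (deriv (ψ t)) r + (1/r) * deriv (ψ t) r
          - (deriv Φ (ψ t r)) ^ 2 * cos (ψ t r) * sin (ψ t r) * (deriv (ψ t) r) ^ 2)
    (φ : ℝ → ℝ → ℝ) (hφ : ∀ t r, φ t r = Φ (ψ t r)) :
    ∀ t ∈ Ioi (0:ℝ), ∀ r ∈ Ioi (0:ℝ),
      (deriv (fun s => ψ s r) t
          = deriv (deriv (ψ t)) r + (1/r) * deriv (ψ t) r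
            - cos (ψ t r) * sin (ψ t r) * (deriv (φ t) r) ^ 2) ∧
      (deriv (fun s => φ s r) t * sin (ψ t r) ^ 2
          = (deriv (deriv (φ t)) r + (1/r) * deriv (φ t) r) * sin (ψ t r) ^ 2
            + 2 * cos (ψ t r) * sin (ψ t r) * deriv (ψ t) r * deriv (φ t) r) := by
  intro t ht r hr
  have hJo : IsOpen J := hJ ▸ isOpen_Ioo
  have hopen : IsOpen (Ioi (0 : ℝ) ×ˢ Ioi (0 : ℝ)) := isOpen_Ioi.prod isOpen_Ioi
  have hψ_at : ∀ x ∈ Ioi (0 : ℝ),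
      ContDiffAt ℝ (⊤ : ℕ∞) (fun q : ℝ × ℝ => ψ q.1 q.2) (t, x) := fun x hx =>
    hψ_smooth.contDiffAt (hopen.mem_nhds ⟨ht, hx⟩)
  have hψ_r : ∀ x ∈ Ioi (0 : ℝ), ContDiffAt ℝ (⊤ : ℕ∞) (ψ t) x := fun x hx =>
    (hψ_at x hx).comp x (contDiffAt_const.prodMk contDiffAt_id)
  have hψ_t : ContDiffAt ℝ (⊤ : ℕ∞) (fun s => ψ s r) t :=
    (hψ_at r hr).comp t (contDiffAt_id.prodMk contDiffAt_const)
  have hΦ_at : ∀ y ∈ J, ContDiffAt ℝ (⊤ : ℕ∞) Φ y := fun y hy =>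
    hΦ.contDiffAt (hJo.mem_nhds hy)
  have hΦ_deriv : ∀ y ∈ J, HasDerivAt Φ (deriv Φ y) y := fun y hy =>
    ((hΦ_at y hy).differentiableAt (by simp)).hasDerivAt
  have hψ_deriv : ∀ x ∈ Ioi (0 : ℝ), HasDerivAt (ψ t) (deriv (ψ t) x) x := fun x hx =>
    ((hψ_r x hx).differentiableAt (by simp)).hasDerivAt
  have hφ_r : ∀ x ∈ Ioi (0 : ℝ), deriv (φ t) x = deriv Φ (ψ t x) * deriv (ψ t) x := by
    intro x hx
    rw [show φ t = Φ ∘ ψ t from funext (hφ t)]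
    exact ((hΦ_deriv _ (hψ_range t ht x hx)).comp x (hψ_deriv x hx)).deriv
  have hφ_t : deriv (fun s => φ s r) t = deriv Φ (ψ t r) * deriv (fun s => ψ s r) t := by
    rw [show (fun s => φ s r) = Φ ∘ fun s => ψ s r from funext fun s => hφ s r]
    exact ((hΦ_deriv _ (hψ_range t ht r hr)).comp t
      (hψ_t.differentiableAt (by simp)).hasDerivAt).deriv
  have hΦ_deriv₂ : HasDerivAt (deriv Φ) (deriv (deriv Φ) (ψ t r)) (ψ t r) :=
    (((hΦ_at _ (hψ_range t ht r hr)).derivWithin (m := (⊤ : ℕ∞))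
      le_rfl).differentiableAt (by simp)).hasDerivAt
  have hψ_deriv₂ : HasDerivAt (deriv (ψ t)) (deriv (deriv (ψ t)) r) r :=
    (((hψ_r r hr).derivWithin (m := (⊤ : ℕ∞)) le_rfl).differentiableAt (by simp)).hasDerivAt
  have hφ_rr : deriv (deriv (φ t)) r
      = deriv (deriv Φ) (ψ t r) * deriv (ψ t) r * deriv (ψ t) r
        + deriv Φ (ψ t r) * deriv (deriv (ψ t)) r := by
    have heq : deriv (φ t) =ᶠ[nhds r] fun x => deriv Φ (ψ t x) * deriv (ψ t) x :=
      Filter.eventuallyEq_of_mem (isOpen_Ioi.mem_nhds hr) hφ_r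
    rw [heq.deriv_eq]
    exact ((hΦ_deriv₂.comp r (hψ_deriv r hr)).mul hψ_deriv₂).deriv
  have hode := hODE _ (hψ_range t ht r hr)
  rw [hφ_t, hφ_rr, hφ_r r hr, hψ_eq t ht r hr]
  refine ⟨by ring, ?_⟩
  linear_combination -(deriv (ψ t) r) ^ 2 * hode
end

section
/- Let J ⊂ (0,π) be an open interval and Φ : J → ℝ a smooth solution of Φ'' sin²ψ + 2Φ' cos ψ sin ψ + (Φ')³ cos ψ sin³ψ = 0 on J such that Φ'(ψ) ≠ 0 for all ψ ∈ J. Then there exists a constant β such that for all ψ ∈ J: 1/(sin²ψ · Φ'(ψ))² = β − 1/sin²ψ; equivalently, β sin²ψ > 1 and (Φ'(ψ))² = 1/((β sin²ψ − 1) sin²ψ) for all ψ ∈ J. -/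
open Real Set

/-- A nowhere-degenerate smooth solution of the ODE
`Φ'' sin²ψ + 2Φ' cos ψ sin ψ + (Φ')³ cos ψ sin³ψ = 0` on an open interval
`J ⊆ (0,π)` satisfies `1/(sin²ψ Φ')² = β − 1/sin²ψ` for some constant `β`;
equivalently `β sin²ψ > 1` and `(Φ')² = 1/((β sin²ψ − 1) sin²ψ)` on `J`. -/
theorem ode_first_integral
    (a b : ℝ) (J : Set ℝ) (hJ : J = Ioo a b) (hJsub : J ⊆ Ioo 0 π)
    (Φ : ℝ → ℝ) (hΦ : ContDiffOn ℝ (⊤ : ℕ∞) Φ J)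
    (hΦ' : ∀ ψ ∈ J, deriv Φ ψ ≠ 0)
    (hODE : ∀ ψ ∈ J,
      deriv (deriv Φ) ψ * sin ψ ^ 2 + 2 * deriv Φ ψ * cos ψ * sin ψ
        + (deriv Φ ψ) ^ 3 * cos ψ * sin ψ ^ 3 = 0) :
    ∃ β : ℝ, ∀ ψ ∈ J,
      (1 / (sin ψ ^ 2 * deriv Φ ψ) ^ 2 = β - 1 / sin ψ ^ 2) ∧
      (1 < β * sin ψ ^ 2) ∧
      ((deriv Φ ψ) ^ 2 = 1 / ((β * sin ψ ^ 2 - 1) * sin ψ ^ 2)) := by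
  have hJo : IsOpen J := hJ ▸ isOpen_Ioo
  have hJc : IsPreconnected J := hJ ▸ isPreconnected_Ioo
  have hsin : ∀ ψ ∈ J, 0 < sin ψ := fun ψ hψ => sin_pos_of_mem_Ioo (hJsub hψ)
  have hΦ'_diff : DifferentiableOn ℝ (deriv Φ) J :=
    (hΦ.deriv_of_isOpen (m := 1) hJo (by norm_cast)).differentiableOn one_ne_zero
  let F : ℝ → ℝ := fun ψ => ((sin ψ ^ 2 * deriv Φ ψ) ^ 2)⁻¹ + (sin ψ ^ 2)⁻¹
  have hF_deriv : ∀ ψ ∈ J, HasDerivAt F 0 ψ := by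
    intro ψ hψ
    have hs := (hsin ψ hψ).ne'
    have hp := hΦ' ψ hψ
    have hsq := (hasDerivAt_sin ψ).pow 2
    have hΦ'' := (hΦ'_diff.differentiableAt (hJo.mem_nhds hψ)).hasDerivAt
    have h := (((hsq.mul hΦ'').pow 2).inv (by simp [hs, hp])).add (hsq.inv (by simp [hs]))
    refine h.congr_deriv ?_
    simp only [Pi.mul_apply, Pi.pow_apply]
    field_simp
    linear_combination (-2 * sin ψ ^ 2 * deriv Φ ψ) * hODE ψ hψ
  obtain ⟨β, hβ⟩ := hJo.exists_is_const_of_deriv_eq_zero hJc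
    (fun ψ hψ => (hF_deriv ψ hψ).differentiableAt.differentiableWithinAt)
    (fun ψ hψ => (hF_deriv ψ hψ).deriv)
  refine ⟨β, fun ψ hψ => ?_⟩
  have hs := hsin ψ hψ
  have hp := hΦ' ψ hψ
  have hFβ : ((sin ψ ^ 2 * deriv Φ ψ) ^ 2)⁻¹ + (sin ψ ^ 2)⁻¹ = β := hβ ψ hψ
  have hsub : β * sin ψ ^ 2 - 1 = 1 / (sin ψ ^ 2 * deriv Φ ψ ^ 2) := by
    rw [← hFβ]
    field_simp
    ring
  refine ⟨by rw [← hFβ]; ring, ?_, ?_⟩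
  · have : 0 < 1 / (sin ψ ^ 2 * deriv Φ ψ ^ 2) := by positivity
    linarith
  · rw [hsub]
    field_simp
end

section
/- Let β > 1 and let ψ : (0,∞) × (0,∞) → ℝ be a smooth function with ψ(t,r) ∈ (0,π) and β sin²ψ(t,r) > 1 for all (t,r), satisfying the nonlinear heat equation ∂ₜψ = ∂ᵣᵣψ + (1/r)∂ᵣψ − (cos ψ /((β sin²ψ − 1) sin ψ)) (∂ᵣψ)². Then v(t,r) = arccos(√(β/(β−1)) · cos ψ(t,r)) satisfies the linear radial heat equation ∂ₜv = ∂ᵣᵣv + (1/r)∂ᵣv on (0,∞) × (0,∞). -/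
open Real Set

/-- If `G` is the derivative of `F` and `p * G` that of `G` along `u`, the second derivative of
the composition of `F` with `u` is `G` times the second derivative of `u` plus `p` times the square
of its first derivative. -/
theorem deriv_deriv_comp_of_hasDerivAt {F G p u : ℝ → ℝ} {s : Set ℝ} (hs : IsOpen s)
    (hu : ContDiffOn ℝ 2 u s)
    (hF : ∀ r ∈ s, HasDerivAt F (G (u r)) (u r))
    (hG : ∀ r ∈ s, HasDerivAt G (p (u r) * G (u r)) (u r)) {r : ℝ} (hr : r ∈ s) :
    deriv (deriv fun ρ => F (u ρ)) r
      = G (u r) * (deriv (deriv u) r + p (u r) * deriv u r ^ 2) := by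
  have hu1 : ∀ ρ ∈ s, HasDerivAt u (deriv u ρ) ρ := fun ρ hρ =>
    ((hu.differentiableOn two_ne_zero).differentiableAt (hs.mem_nhds hρ)).hasDerivAt
  have hu2 : HasDerivAt (deriv u) (deriv (deriv u) r) r :=
    (((hu.deriv_of_isOpen (m := 1) hs (by norm_num)).differentiableOn one_ne_zero).differentiableAt
      (hs.mem_nhds hr)).hasDerivAt
  have heq : (deriv fun ρ => F (u ρ)) =ᶠ[nhds r] fun ρ => G (u ρ) * deriv u ρ := by
    filter_upwards [hs.mem_nhds hr] with ρ hρ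
    exact ((hF ρ hρ).comp ρ (hu1 ρ hρ)).deriv
  refine heq.deriv_eq.trans ((((hG r hr).comp r (hu1 r hr)).mul hu2).congr_deriv ?_).deriv
  simp only [Function.comp_apply]
  ring

theorem one_sub_sq_sqrt_div_mul_cos {β : ℝ} (hβ : 1 < β) (x : ℝ) :
    1 - (√(β / (β - 1)) * cos x) ^ 2 = (β * sin x ^ 2 - 1) / (β - 1) := by
  have hβ' : 0 < β - 1 := by linarith
  rw [mul_pow, sq_sqrt (by positivity), cos_sq']
  field_simp
  ring

theorem hasDerivAt_arccos_mul_cos {k x : ℝ} (h : 0 < 1 - (k * cos x) ^ 2) :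
    HasDerivAt (fun y => arccos (k * cos y)) (k * sin x / √(1 - (k * cos x) ^ 2)) x := by
  have h1 : k * cos x ≠ -1 := fun e => by simp [e] at h
  have h2 : k * cos x ≠ 1 := fun e => by simp [e] at h
  refine ((hasDerivAt_arccos h1 h2).comp x ((hasDerivAt_cos x).const_mul k)).congr_deriv ?_
  ring

theorem hasDerivAt_mul_sin_div_sqrt {k x : ℝ} (h : 0 < 1 - (k * cos x) ^ 2) :
    HasDerivAt (fun y => k * sin y / √(1 - (k * cos y) ^ 2))
      (k * cos x * (1 - k ^ 2) / ((1 - (k * cos x) ^ 2) * √(1 - (k * cos x) ^ 2))) x := by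
  have hD := ((((hasDerivAt_cos x).const_mul k).fun_pow 2).const_sub 1).sqrt h.ne'
  have hs := sqrt_pos.2 h
  have hq := sq_sqrt h.le
  refine (((hasDerivAt_sin x).const_mul k).fun_div hD hs.ne').congr_deriv ?_
  set w := √(1 - (k * cos x) ^ 2)
  rw [← hq]
  field_simp
  rw [hq]
  push_cast
  linear_combination (-2 * k ^ 3 * cos x) * sin_sq_add_cos_sq x

/-- The Hopf–Cole-type transformation
`v = arccos(√(β/(β−1)) cos ψ)` turns the nonlinear heat equation
`∂ₜψ = ∂ᵣᵣψ + (1/r)∂ᵣψ − (cos ψ /((β sin²ψ − 1) sin ψ))(∂ᵣψ)²`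
into the linear radial heat equation `∂ₜv = ∂ᵣᵣv + (1/r)∂ᵣv`. -/
theorem hopf_cole_linearizes
    (β : ℝ) (hβ : 1 < β)
    (ψ : ℝ → ℝ → ℝ)
    (hψ_smooth : ContDiffOn ℝ (⊤ : ℕ∞) (fun q : ℝ × ℝ => ψ q.1 q.2) (Ioi 0 ×ˢ Ioi 0))
    (hψ_range : ∀ t ∈ Ioi (0:ℝ), ∀ r ∈ Ioi (0:ℝ),
      ψ t r ∈ Ioo 0 π ∧ 1 < β * sin (ψ t r) ^ 2)
    (hψ_eq : ∀ t ∈ Ioi (0:ℝ), ∀ r ∈ Ioi (0:ℝ),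
      deriv (fun s => ψ s r) t
        = deriv (deriv (ψ t)) r + (1/r) * deriv (ψ t) r
          - (cos (ψ t r) / ((β * sin (ψ t r) ^ 2 - 1) * sin (ψ t r)))
              * (deriv (ψ t) r) ^ 2)
    (v : ℝ → ℝ → ℝ)
    (hv : ∀ t r, v t r = arccos (Real.sqrt (β / (β - 1)) * cos (ψ t r))) :
    ∀ t ∈ Ioi (0:ℝ), ∀ r ∈ Ioi (0:ℝ),
      deriv (fun s => v s r) t
        = deriv (deriv (v t)) r + (1/r) * deriv (v t) r := by
  intro t ht r hr
  have hβ' : 0 < β - 1 := by linarith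
  set k := √(β / (β - 1)) with hk
  have hk2 : 1 - k ^ 2 = -1 / (β - 1) := by
    rw [hk, sq_sqrt (by positivity)]
    field_simp
    ring
  have hpos : ∀ ρ ∈ Ioi (0 : ℝ), 0 < 1 - (k * cos (ψ t ρ)) ^ 2 := fun ρ hρ => by
    rw [one_sub_sq_sqrt_div_mul_cos hβ]
    exact div_pos (by linarith [(hψ_range t ht ρ hρ).2]) hβ'
  have hvt : v t = fun ρ => arccos (k * cos (ψ t ρ)) := funext (hv t)
  have hvr : (fun s => v s r) = fun s => arccos (k * cos (ψ s r)) := funext fun s => hv s r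
  have hu : ContDiffOn ℝ 2 (ψ t) (Ioi 0) :=
    (hψ_smooth.of_le (WithTop.coe_le_coe.2 (le_top : (2 : ℕ∞) ≤ ⊤))).comp
      (contDiff_const.prodMk contDiff_id).contDiffOn fun ρ hρ => ⟨ht, hρ⟩
  have hw : ContDiffOn ℝ 2 (fun s => ψ s r) (Ioi 0) :=
    (hψ_smooth.of_le (WithTop.coe_le_coe.2 (le_top : (2 : ℕ∞) ≤ ⊤))).comp
      (contDiff_id.prodMk contDiff_const).contDiffOn fun s hs => ⟨hs, hr⟩
  have hut := ((hw.differentiableOn two_ne_zero).differentiableAt (Ioi_mem_nhds ht)).hasDerivAt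
  have hur := ((hu.differentiableOn two_ne_zero).differentiableAt (Ioi_mem_nhds hr)).hasDerivAt
  have hF := hasDerivAt_arccos_mul_cos (hpos r hr)
  have hv_t := (hF.comp t hut).deriv
  have hv_r := (hF.comp r hur).deriv
  have hv_rr := deriv_deriv_comp_of_hasDerivAt
    (p := fun x => -(cos x / ((β * sin x ^ 2 - 1) * sin x))) isOpen_Ioi hu
    (fun ρ hρ => hasDerivAt_arccos_mul_cos (hpos ρ hρ))
    (fun ρ hρ => by
      refine (hasDerivAt_mul_sin_div_sqrt (hpos ρ hρ)).congr_deriv ?_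
      have hw := sqrt_pos.2 (hpos ρ hρ)
      have hsin : 0 < sin (ψ t ρ) := sin_pos_of_mem_Ioo (hψ_range t ht ρ hρ).1
      have hd : 0 < β * sin (ψ t ρ) ^ 2 - 1 := by linarith [(hψ_range t ht ρ hρ).2]
      set w := √(1 - (k * cos (ψ t ρ)) ^ 2)
      rw [hk2, one_sub_sq_sqrt_div_mul_cos hβ]
      field_simp) hr
  simp only [Function.comp_def] at hv_t hv_r
  rw [hvr, hvt, hv_t, hv_r, hv_rr, hψ_eq t ht r hr]
  ring
end

section
/- Let f : ℝ² → ℝ be bounded and continuous with lim_{|x|→∞} f(x) = L. Then the heat extension u(t,x) = ∫_{ℝ²} Γ(t, x − y) f(y) dy converges to the constant L uniformly on ℝ² as t → ∞, i.e. sup_{x ∈ ℝ²} |u(t,x) − L| → 0 as t → ∞. -/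
open Real Set MeasureTheory Filter

noncomputable section

/-- The two-dimensional heat kernel `Γ(t,z) = (4πt)⁻¹ e^{−|z|²/(4t)}`. -/
def heatKernel2 (t : ℝ) (z : EuclideanSpace ℝ (Fin 2)) : ℝ :=
  (4 * π * t)⁻¹ * Real.exp (-‖z‖ ^ 2 / (4 * t))

theorem heatKernel2_nonneg {t : ℝ} (ht : 0 < t) (z : EuclideanSpace ℝ (Fin 2)) :
    0 ≤ heatKernel2 t z := by
  unfold heatKernel2; positivity

theorem heatKernel2_le {t : ℝ} (ht : 0 < t) (z : EuclideanSpace ℝ (Fin 2)) :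
    heatKernel2 t z ≤ (4 * π * t)⁻¹ := by
  refine mul_le_of_le_one_right (by positivity) (Real.exp_le_one_iff.2 ?_)
  rw [neg_div]
  exact neg_nonpos.2 (by positivity)

theorem integral_heatKernel2 {t : ℝ} (ht : 0 < t) : ∫ z, heatKernel2 t z = 1 := by
  have h := GaussianFourier.integral_rexp_neg_mul_sq_norm
    (V := EuclideanSpace ℝ (Fin 2)) (b := (4 * t)⁻¹) (by positivity)
  have heq : ∀ z, heatKernel2 t z = (4 * π * t)⁻¹ * Real.exp (-(4 * t)⁻¹ * ‖z‖ ^ 2) := by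
    intro z
    rw [heatKernel2]
    congr 2
    ring
  simp_rw [heq]
  rw [integral_const_mul, h]
  simp
  field_simp

theorem integrable_heatKernel2 {t : ℝ} (ht : 0 < t) : Integrable (heatKernel2 t) :=
  .of_integral_ne_zero (by rw [integral_heatKernel2 ht]; exact one_ne_zero)

/-- If `f` is bounded continuous on `ℝ²` with `f(x) → L` as
`|x| → ∞`, then its heat extension converges to `L` uniformly on `ℝ²` as
`t → ∞`. -/
theorem heat_extension_uniform_limit
    (f : EuclideanSpace ℝ (Fin 2) → ℝ) (L : ℝ)
    (hf_cont : Continuous f) (hf_bdd : ∃ C, ∀ x, |f x| ≤ C)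
    (hf_lim : Tendsto f (cocompact (EuclideanSpace ℝ (Fin 2))) (nhds L))
    (u : ℝ → EuclideanSpace ℝ (Fin 2) → ℝ)
    (hu : ∀ t x, u t x = ∫ y, heatKernel2 t (x - y) * f y) :
    TendstoUniformly (fun t x => u t x) (fun _ => L) atTop := by
  obtain ⟨C, hC⟩ := hf_bdd
  rw [Metric.tendstoUniformly_iff]
  intro ε hε
  obtain ⟨K, hK, hKf⟩ := mem_cocompact.1 (hf_lim (Metric.closedBall_mem_nhds L (half_pos hε)))
  set M : ℝ := C + |L|
  have hM : ∀ y, |f y - L| ≤ M := fun y => (norm_sub_le (f y) L).trans (add_le_add_left (hC y) _)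
  have hM0 : 0 ≤ M := (abs_nonneg _).trans (hM 0)
  have hlim : Tendsto (fun t : ℝ => ε / 2 + volume.real K * ((4 * π * t)⁻¹ * M)) atTop
      (nhds (ε / 2 + volume.real K * (0 * M))) :=
    (((tendsto_inv_atTop_zero.comp (tendsto_id.const_mul_atTop (by positivity))).mul_const
      M).const_mul _).const_add _
  filter_upwards [hlim.eventually (gt_mem_nhds (show _ < ε by simpa using half_lt_self hε)),
    eventually_gt_atTop 0] with t ht ht0 x
  have hint : Integrable (fun y => heatKernel2 t (x - y)) :=
    (integrable_heatKernel2 ht0).comp_sub_left x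
  have hmass : ∫ y, heatKernel2 t (x - y) = 1 := by
    rw [integral_sub_left_eq_self (heatKernel2 t), integral_heatKernel2 ht0]
  have hintf : Integrable (fun y => heatKernel2 t (x - y) * f y) :=
    hint.mul_bdd hf_cont.aestronglyMeasurable (.of_forall hC)
  have hind : Integrable (K.indicator fun _ => (4 * π * t)⁻¹ * M) :=
    (integrable_indicator_iff hK.measurableSet).2
      (integrableOn_const hK.measure_lt_top.ne)
  have hsub : u t x - L = ∫ y, heatKernel2 t (x - y) * (f y - L) := by
    simp_rw [mul_sub]
    rw [integral_sub hintf (hint.mul_const L), integral_mul_const, hmass, hu, one_mul]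
  rw [dist_comm, Real.dist_eq, hsub]
  refine lt_of_le_of_lt ?_ ht
  calc |∫ y, heatKernel2 t (x - y) * (f y - L)|
      ≤ ∫ y, (heatKernel2 t (x - y) * (ε / 2) + K.indicator (fun _ => (4 * π * t)⁻¹ * M) y) := by
        rw [← Real.norm_eq_abs]
        refine norm_integral_le_of_norm_le ((hint.mul_const (ε / 2)).add hind) (.of_forall fun y => ?_)
        have h0 := heatKernel2_nonneg ht0 (x - y)
        rw [norm_mul, Real.norm_eq_abs, Real.norm_eq_abs, abs_of_nonneg h0]
        by_cases hy : y ∈ K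
        · rw [indicator_of_mem hy]
          have := mul_le_mul (heatKernel2_le ht0 (x - y)) (hM y) (abs_nonneg _) (by positivity)
          have : 0 ≤ heatKernel2 t (x - y) * (ε / 2) := by positivity
          linarith
        · rw [indicator_of_notMem hy, add_zero]
          have : |f y - L| ≤ ε / 2 := hKf hy
          gcongr
    _ = ε / 2 + volume.real K * ((4 * π * t)⁻¹ * M) := by
        rw [integral_add (hint.mul_const _) hind, integral_mul_const, hmass, one_mul,
          integral_indicator_const _ hK.measurableSet, smul_eq_mul]

end
end

section
/- Define g : (0,∞) → ℝ by: g(r) = 1/(r·((6k+2)³ − (6k+1)³)) for r ∈ (e^{(6k+1)³}, e^{(6k+2)³}], g(r) = −1/(r·((6k+5)³ − (6k+4)³)) for r ∈ (e^{(6k+4)³}, e^{(6k+5)³}], and g(r) = 0 otherwise (k ranging over ℕ, and g = 0 on (0, e]), and set v₀(r) = ∫₀^r g(s) ds. Then 0 ≤ v₀(r) ≤ 1 for all r ≥ 0, and for every k ∈ ℕ: v₀(r) = 1 for r ∈ [e^{(6k+2)³}, e^{(6k+4)³}] and v₀(r) = 0 for r ∈ [e^{(6k+5)³}, e^{(6k+7)³}].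 -/
open Real Set MeasureTheory

noncomputable section

/-- The radial derivative profile of the non-shrinking example:
`g(r) = 1/(r((6k+2)³−(6k+1)³))` on `(e^{(6k+1)³}, e^{(6k+2)³}]`,
`g(r) = −1/(r((6k+5)³−(6k+4)³))` on `(e^{(6k+4)³}, e^{(6k+5)³}]` (`k ∈ ℕ`),
and `g = 0` elsewhere (in particular on `(0, e]`). -/
def g (r : ℝ) : ℝ :=
  (∑' k : ℕ,
    (Ioc (Real.exp ((6*(k:ℝ)+1)^3)) (Real.exp ((6*(k:ℝ)+2)^3))).indicator
      (fun ρ => 1 / (ρ * ((6*(k:ℝ)+2)^3 - (6*(k:ℝ)+1)^3))) r)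
  - (∑' k : ℕ,
    (Ioc (Real.exp ((6*(k:ℝ)+4)^3)) (Real.exp ((6*(k:ℝ)+5)^3))).indicator
      (fun ρ => 1 / (ρ * ((6*(k:ℝ)+5)^3 - (6*(k:ℝ)+4)^3))) r)

/-- The density of a logarithmic ramp of total mass one on `(e^a, e^b]`. -/
def logRampDensity (a b : ℝ) : ℝ → ℝ :=
  (Ioc (Real.exp a) (Real.exp b)).indicator (fun ρ => 1 / (ρ * (b - a)))

lemma logRampDensity_eq_zero_of_le {a b s : ℝ} (hs : s ≤ Real.exp a) :
    logRampDensity a b s = 0 :=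
  indicator_of_notMem (fun h => not_lt_of_ge hs h.1) _

lemma logRampDensity_eq_zero_of_lt {a b s : ℝ} (hs : Real.exp b < s) :
    logRampDensity a b s = 0 :=
  indicator_of_notMem (fun h => not_lt_of_ge h.2 hs) _

lemma logRampDensity_nonneg {a b : ℝ} (hab : a < b) (s : ℝ) : 0 ≤ logRampDensity a b s := by
  refine indicator_nonneg (fun x hx => ?_) s
  have h1 : 0 < x := (Real.exp_pos a).trans hx.1
  have h2 : 0 < b - a := sub_pos.2 hab
  positivity

lemma integrable_logRampDensity {a b : ℝ} (hab : a < b) :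
    Integrable (logRampDensity a b) volume := by
  refine (integrable_indicator_iff measurableSet_Ioc).2 ?_
  refine IntegrableOn.mono_set (ContinuousOn.integrableOn_Icc ?_) Ioc_subset_Icc_self
  intro x hx
  have h1 : x ≠ 0 := ((Real.exp_pos a).trans_le hx.1).ne'
  have h2 : b - a ≠ 0 := (sub_pos.2 hab).ne'
  exact ContinuousAt.continuousWithinAt (by fun_prop (disch := positivity))

/-- The integral of a logarithmic ramp density, starting from the origin. -/
def logRamp (a b r : ℝ) : ℝ := ∫ s in (0:ℝ)..r, logRampDensity a b s

lemma logRamp_eq_zero {a b r : ℝ} (hr : r ≤ Real.exp a) : logRamp a b r = 0 := by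
  refine intervalIntegral.integral_zero_ae (Filter.Eventually.of_forall fun s hs => ?_)
  refine logRampDensity_eq_zero_of_le (hs.2.trans ?_)
  exact max_le (Real.exp_pos a).le hr

lemma logRamp_eq_one {a b r : ℝ} (hab : a < b) (hr : Real.exp b ≤ r) : logRamp a b r = 1 := by
  have h2 : b - a ≠ 0 := (sub_pos.2 hab).ne'
  have hle : Real.exp a ≤ Real.exp b := Real.exp_le_exp.2 hab.le
  have hr0 : 0 ≤ r := (Real.exp_pos b).le.trans hr
  have hsub : Ioc (0:ℝ) r ∩ Ioc (Real.exp a) (Real.exp b) = Ioc (Real.exp a) (Real.exp b) :=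
    inter_eq_right.2 (Ioc_subset_Ioc (Real.exp_pos a).le hr)
  have hmul : ∀ ρ : ℝ, 1 / (ρ * (b - a)) = (b - a)⁻¹ * ρ⁻¹ := fun ρ => by
    rw [one_div, mul_inv, mul_comm]
  rw [logRamp, intervalIntegral.integral_of_le hr0]
  unfold logRampDensity
  rw [setIntegral_indicator measurableSet_Ioc, hsub, ← intervalIntegral.integral_of_le hle]
  simp only [hmul]
  rw [intervalIntegral.integral_const_mul, integral_inv_of_pos (Real.exp_pos a) (Real.exp_pos b),
    Real.log_div (Real.exp_pos b).ne' (Real.exp_pos a).ne', Real.log_exp, Real.log_exp,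
    inv_mul_cancel₀ h2]

lemma monotoneOn_logRamp {a b : ℝ} (hab : a < b) : MonotoneOn (logRamp a b) (Ici 0) := by
  intro x hx y _ hxy
  exact intervalIntegral.integral_mono_interval le_rfl hx hxy
    (Filter.Eventually.of_forall (logRampDensity_nonneg hab))
    (integrable_logRampDensity hab).intervalIntegrable

lemma logRamp_mem_Icc {a b r : ℝ} (hab : a < b) (hr : 0 ≤ r) : logRamp a b r ∈ Icc (0:ℝ) 1 := by
  refine ⟨intervalIntegral.integral_nonneg hr fun s _ => logRampDensity_nonneg hab s, ?_⟩
  rw [← logRamp_eq_one hab (le_max_right r (Real.exp b))]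
  exact monotoneOn_logRamp hab hr (hr.trans (le_max_left _ _)) (le_max_left _ _)

lemma exp_cube_le_exp_cube {x y : ℝ} (hx : 0 ≤ x) (hxy : x ≤ y) :
    Real.exp (x ^ 3) ≤ Real.exp (y ^ 3) :=
  Real.exp_le_exp.2 (pow_le_pow_left₀ hx hxy 3)

lemma g_eq_sum {N : ℕ} {s : ℝ} (hs : s ≤ Real.exp ((6*(N:ℝ)+1)^3)) :
    g s = ∑ k ∈ Finset.range N,
      (logRampDensity ((6*(k:ℝ)+1)^3) ((6*(k:ℝ)+2)^3) s
        - logRampDensity ((6*(k:ℝ)+4)^3) ((6*(k:ℝ)+5)^3) s) := by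
  have key : ∀ k ∉ Finset.range N, ∀ c d : ℝ, 1 ≤ c →
      logRampDensity ((6*(k:ℝ)+c)^3) d s = 0 := by
    intro k hk c d hc
    have hk' : (N:ℝ) ≤ k := by exact_mod_cast not_lt.1 (Finset.mem_range.not.1 hk)
    exact logRampDensity_eq_zero_of_le (hs.trans (exp_cube_le_exp_cube (by positivity)
      (by linarith)))
  rw [Finset.sum_sub_distrib,
    ← tsum_eq_sum (L := .unconditional ℕ) fun k hk => key k hk 1 _ le_rfl,
    ← tsum_eq_sum (L := .unconditional ℕ) fun k hk => key k hk 4 _ (by norm_num)]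
  rfl

lemma integral_g_eq_sum {N : ℕ} {r : ℝ} (hr : r ≤ Real.exp ((6*(N:ℝ)+1)^3)) :
    ∫ s in (0:ℝ)..r, g s = ∑ k ∈ Finset.range N,
      (logRamp ((6*(k:ℝ)+1)^3) ((6*(k:ℝ)+2)^3) r
        - logRamp ((6*(k:ℝ)+4)^3) ((6*(k:ℝ)+5)^3) r) := by
  have hint : ∀ (k : ℕ) (c d : ℝ), 0 ≤ c → c < d → IntervalIntegrable
      (logRampDensity ((6*(k:ℝ)+c)^3) ((6*(k:ℝ)+d)^3)) volume 0 r := fun k c d hc hcd =>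
    (integrable_logRampDensity (pow_lt_pow_left₀ (by linarith) (by positivity)
      (by norm_num))).intervalIntegrable
  have hcongr : EqOn g (fun s => ∑ k ∈ Finset.range N,
      (logRampDensity ((6*(k:ℝ)+1)^3) ((6*(k:ℝ)+2)^3) s
        - logRampDensity ((6*(k:ℝ)+4)^3) ((6*(k:ℝ)+5)^3) s)) (uIcc 0 r) := fun s hs =>
    g_eq_sum (hs.2.trans (max_le (Real.exp_pos _).le hr))
  rw [intervalIntegral.integral_congr hcongr, intervalIntegral.integral_finsetSum]
  · refine Finset.sum_congr rfl fun k _ => ?_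
    exact intervalIntegral.integral_sub (hint k 1 2 (by norm_num) (by norm_num))
      (hint k 4 5 (by norm_num) (by norm_num))
  · exact fun k _ => (hint k 1 2 (by norm_num) (by norm_num)).sub
      (hint k 4 5 (by norm_num) (by norm_num))

lemma logRamp_cube_eq_one (k : ℕ) {c d r : ℝ} (hc : 0 ≤ c) (hcd : c < d)
    (hr : Real.exp ((6*(k:ℝ)+d)^3) ≤ r) :
    logRamp ((6*(k:ℝ)+c)^3) ((6*(k:ℝ)+d)^3) r = 1 :=
  logRamp_eq_one (pow_lt_pow_left₀ (by linarith) (by positivity) (by norm_num)) hr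

lemma logRamp_cube_mem_Icc (k : ℕ) {c d r : ℝ} (hc : 0 ≤ c) (hcd : c < d) (hr : 0 ≤ r) :
    logRamp ((6*(k:ℝ)+c)^3) ((6*(k:ℝ)+d)^3) r ∈ Icc (0:ℝ) 1 :=
  logRamp_mem_Icc (pow_lt_pow_left₀ (by linarith) (by positivity) (by norm_num)) hr

lemma six_mul_succ_add_one (k : ℕ) : 6*((k + 1 : ℕ):ℝ)+1 = 6*(k:ℝ)+7 := by
  push_cast
  ring

/-- On one period only the corresponding pair of ramps contributes to the primitive of `g`. -/
lemma integral_g_eq_sub {k : ℕ} {r : ℝ}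
    (hr : r ∈ Icc (Real.exp ((6*(k:ℝ)+1)^3)) (Real.exp ((6*(k:ℝ)+7)^3))) :
    ∫ s in (0:ℝ)..r, g s = logRamp ((6*(k:ℝ)+1)^3) ((6*(k:ℝ)+2)^3) r
      - logRamp ((6*(k:ℝ)+4)^3) ((6*(k:ℝ)+5)^3) r := by
  have hr' : r ≤ Real.exp ((6*((k + 1 : ℕ):ℝ)+1)^3) := by
    rw [six_mul_succ_add_one]
    exact hr.2
  rw [integral_g_eq_sum hr', Finset.sum_range_succ, Finset.sum_eq_zero, zero_add]
  intro j hj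
  have hjk : (j:ℝ) + 1 ≤ k := by exact_mod_cast Finset.mem_range.1 hj
  rw [logRamp_cube_eq_one j (by norm_num) (by norm_num), logRamp_cube_eq_one j (by norm_num)
    (by norm_num), sub_self]
  all_goals
    exact (exp_cube_le_exp_cube (by positivity) (by linarith)).trans hr.1

lemma integral_g_mem_Icc_of_period {k : ℕ} {r : ℝ}
    (hr : r ∈ Icc (Real.exp ((6*(k:ℝ)+1)^3)) (Real.exp ((6*(k:ℝ)+7)^3))) :
    ∫ s in (0:ℝ)..r, g s ∈ Icc (0:ℝ) 1 := by
  have hr0 : 0 ≤ r := (Real.exp_pos _).le.trans hr.1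
  obtain ⟨h1, h2⟩ := logRamp_cube_mem_Icc k (c := 1) (d := 2) (by norm_num) (by norm_num) hr0
  obtain ⟨h3, h4⟩ := logRamp_cube_mem_Icc k (c := 4) (d := 5) (by norm_num) (by norm_num) hr0
  rw [integral_g_eq_sub hr]
  rcases le_total r (Real.exp ((6*(k:ℝ)+4)^3)) with h | h
  · rw [logRamp_eq_zero h, sub_zero]
    exact ⟨h1, h2⟩
  · rw [logRamp_cube_eq_one k (by norm_num) (by norm_num)
      ((exp_cube_le_exp_cube (by positivity) (by linarith)).trans h)]
    constructor <;> linarith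

lemma integral_g_mem_Icc_of_le (N : ℕ) {r : ℝ} (hr : r ≤ Real.exp ((6*(N:ℝ)+1)^3)) :
    ∫ s in (0:ℝ)..r, g s ∈ Icc (0:ℝ) 1 := by
  induction N with
  | zero => simp [integral_g_eq_sum hr]
  | succ n ih =>
    rcases le_total r (Real.exp ((6*(n:ℝ)+1)^3)) with h | h
    · exact ih h
    · refine integral_g_mem_Icc_of_period ⟨h, ?_⟩
      rwa [six_mul_succ_add_one] at hr

/-- The primitive `v₀(r) = ∫₀^r g(s) ds` satisfies
`0 ≤ v₀ ≤ 1`, with `v₀ = 1` on `[e^{(6k+2)³}, e^{(6k+4)³}]` and `v₀ = 0` on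
`[e^{(6k+5)³}, e^{(6k+7)³}]` for every `k ∈ ℕ`. -/
theorem oscillating_profile_values
    (v₀ : ℝ → ℝ) (hv₀ : ∀ r : ℝ, v₀ r = ∫ s in (0:ℝ)..r, g s) :
    (∀ r : ℝ, 0 ≤ r → v₀ r ∈ Icc (0:ℝ) 1) ∧
    (∀ k : ℕ, ∀ r ∈ Icc (Real.exp ((6*(k:ℝ)+2)^3)) (Real.exp ((6*(k:ℝ)+4)^3)),
      v₀ r = 1) ∧
    (∀ k : ℕ, ∀ r ∈ Icc (Real.exp ((6*(k:ℝ)+5)^3)) (Real.exp ((6*(k:ℝ)+7)^3)),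
      v₀ r = 0) := by
  refine ⟨fun r _ => ?_, fun k r hr => ?_, fun k r hr => ?_⟩
  · obtain ⟨N, hN⟩ := exists_nat_ge r
    have h1 : (1:ℝ) ≤ 6*(N:ℝ)+1 := by linarith [(Nat.cast_nonneg N : (0:ℝ) ≤ N)]
    have h2 : 6*(N:ℝ)+1 ≤ (6*(N:ℝ)+1)^3 := le_self_pow₀ h1 (by norm_num)
    rw [hv₀]
    refine integral_g_mem_Icc_of_le N ?_
    linarith [Real.add_one_le_exp ((6*(N:ℝ)+1)^3)]
  · rw [hv₀, integral_g_eq_sub ⟨?_, ?_⟩, logRamp_cube_eq_one k (by norm_num) (by norm_num) hr.1,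
      logRamp_eq_zero hr.2, sub_zero]
    · exact (exp_cube_le_exp_cube (by positivity) (by linarith)).trans hr.1
    · exact hr.2.trans (exp_cube_le_exp_cube (by positivity) (by linarith))
  · rw [hv₀, integral_g_eq_sub ⟨?_, hr.2⟩, logRamp_cube_eq_one k (by norm_num) (by norm_num) ?_,
      logRamp_cube_eq_one k (by norm_num) (by norm_num) hr.1, sub_self]
    all_goals exact (exp_cube_le_exp_cube (by positivity) (by linarith)).trans hr.1

end
end
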